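/- The group ℤ^{d+3} (d ≥ 0) has the finite-step retaining property of degree d+1 but not the finite-step retaining property of degree d; hence the finite-step retaining properties of degrees d and d+1 are not equivalent. -/

import Mathlib

/-- The growth comparison relation: `f ≼ g` iff there is `C > 0` with
`f n ≤ C * g (C*n + C) + C` for all `n`. -/
def GrowthLE (f g : ℕ → ℕ) : Prop :=
  ∃ C : ℕ, 0 < C ∧ ∀ n, f n ≤ C * g (C * n + C) + C

/-- Equivalence of growth rates. -/
def GrowthEquiv (f g : ℕ → ℕ) : Prop := GrowthLE f g ∧ GrowthLE g f

/-- The growth function of a subset `U` of a metric space, with basepoint set `A`: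
`n ↦ #(U ∩ B(A, n))`. -/
noncomputable def relGrowth {X : Type*} [MetricSpace X] (U A : Set X) : ℕ → ℕ :=
  fun n => Set.ncard {x | x ∈ U ∧ ∃ a ∈ A, dist a x ≤ (n : ℝ)}

/-- A metric space is discrete and proper iff all balls (of integer radius) are finite. -/
def DiscreteProper (X : Type*) [MetricSpace X] : Prop :=
  ∀ (x : X) (n : ℕ), {y : X | dist x y ≤ (n : ℝ)}.Finite

/-- Uniformly proper: there is a uniform bound on cardinalities of all balls of radius `n`. -/
def UniformlyProper (X : Type*) [MetricSpace X] : Prop :=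
  ∃ g : ℕ → ℕ, ∀ (x : X) (n : ℕ),
    {y : X | dist x y ≤ (n : ℝ)}.Finite ∧ Set.ncard {y : X | dist x y ≤ (n : ℝ)} ≤ g n

/-- A `c`-quasi-isometry between metric spaces. -/
def IsQuasiIsometryMS {X Y : Type*} [MetricSpace X] [MetricSpace Y] (c : ℝ) (φ : X → Y) : Prop :=
  1 ≤ c ∧
  (∀ a b : X, dist a b / c - c ≤ dist (φ a) (φ b) ∧ dist (φ a) (φ b) ≤ c * dist a b + c) ∧
  (∀ y : Y, ∃ x : X, dist (φ x) y ≤ c)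

/-- Growth function of `U ⊆ V(G)` (with the metric induced by the path-metric of `G`)
with respect to basepoint set `A`. -/
noncomputable def graphGrowth {V : Type*} (G : SimpleGraph V) (U A : Set V) : ℕ → ℕ :=
  fun n => Set.ncard {v | v ∈ U ∧ ∃ a ∈ A, G.dist a v ≤ n}

/-- `Growth(U) = Growth(G)` for `U` a set of vertices of `G` with the induced metric. -/
def GrowthEqFull {V : Type*} (G : SimpleGraph V) (U : Set V) : Prop :=
  ∃ u₀ ∈ U, GrowthEquiv (graphGrowth G Set.univ {u₀}) (graphGrowth G U {u₀})

/-- The set of vertices protected up to (and including) time `n`. -/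
def protectedUpTo {V : Type*} (W : ℕ → Set V) (n : ℕ) : Set V :=
  ⋃ i ∈ Finset.Icc 1 n, W i

/-- The set of vertices on fire at time `n`, for fire reach `r`, strategy `W` and
initial fire `X0`: `X (n+1)` consists of vertices joined to `X n` by a path of length
at most `r` avoiding `(W 1 ∪ ⋯ ∪ W (n+1)) \ X n`. -/
def fireSet {V : Type*} (G : SimpleGraph V) (r : ℕ) (W : ℕ → Set V) (X0 : Set V) : ℕ → Set V
  | 0 => X0
  | n + 1 =>
    {v | ∃ u ∈ fireSet G r W X0 n, ∃ p : G.Walk u v, p.length ≤ r ∧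
      ∀ x ∈ p.support, x ∉ protectedUpTo W (n + 1) \ fireSet G r W X0 n}

/-- The set of vertices on fire at the end of the game. -/
def burnedSet {V : Type*} (G : SimpleGraph V) (r : ℕ) (W : ℕ → Set V) (X0 : Set V) : Set V :=
  ⋃ n, fireSet G r W X0 n

/-- An `{f n}`-strategy: at each time `n ≥ 1` at most `f n` vertices are protected. -/
def IsStrategyBound {V : Type*} (f : ℕ → ℕ) (W : ℕ → Set V) : Prop :=
  ∀ n, 1 ≤ n → (W n).Finite ∧ (W n).ncard ≤ f n

/-- A finite-step strategy protects no vertices after some finite time. -/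
def FiniteStepStrategy {V : Type*} (W : ℕ → Set V) : Prop :=
  ∃ N, ∀ n, N ≤ n → W n = ∅

/-- A retaining `({f n}, r)`-strategy for the initial fire `X0`. -/
def IsRetainingStrategy {V : Type*} (G : SimpleGraph V) (f : ℕ → ℕ) (r : ℕ)
    (X0 : Set V) (W : ℕ → Set V) : Prop :=
  IsStrategyBound f W ∧ GrowthEqFull G (burnedSet G r W X0)ᶜ

/-- The `({f n}, r)`-retaining property. -/
def RetainingProperty {V : Type*} (G : SimpleGraph V) (f : ℕ → ℕ) (r : ℕ) : Prop :=
  ∀ X0 : Set V, X0.Finite → ∃ W, IsRetainingStrategy G f r X0 W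

/-- Polynomial retaining property of degree `d` (fire reach one). -/
def PolyRetaining {V : Type*} (G : SimpleGraph V) (d : ℕ) : Prop :=
  ∃ K : ℕ, 0 < K ∧ RetainingProperty G (fun n => K * n ^ d) 1

/-- The finite-step `{f n}`-retaining property (fire reach one). -/
def FiniteStepRetainingProperty {V : Type*} (G : SimpleGraph V) (f : ℕ → ℕ) : Prop :=
  ∀ X0 : Set V, X0.Finite → ∃ W, IsRetainingStrategy G f 1 X0 W ∧ FiniteStepStrategy W

/-- The finite-step polynomial retaining property of degree `d`. -/
def FiniteStepPolyRetaining {V : Type*} (G : SimpleGraph V) (d : ℕ) : Prop :=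
  ∃ K : ℕ, 0 < K ∧ FiniteStepRetainingProperty G (fun n => K * n ^ d)

/-- The `({f n}, r)`-containment property. -/
def ContainmentProperty {V : Type*} (G : SimpleGraph V) (f : ℕ → ℕ) (r : ℕ) : Prop :=
  ∀ X0 : Set V, X0.Finite →
    ∃ W, IsStrategyBound f W ∧ (burnedSet G r W X0).Finite

/-- Polynomial containment property of degree `d` (fire reach one). -/
def PolyContainment {V : Type*} (G : SimpleGraph V) (d : ℕ) : Prop :=
  ∃ K : ℕ, 0 < K ∧ ContainmentProperty G (fun n => K * n ^ d) 1

/-- The constant containment property. -/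
def ConstantContainment {V : Type*} (G : SimpleGraph V) : Prop := PolyContainment G 0

/-- `D` is (the vertex set of) a connected component of `G \ K`. -/
def ComponentAvoiding {V : Type*} (G : SimpleGraph V) (K D : Set V) : Prop :=
  D.Nonempty ∧ D ⊆ Kᶜ ∧
  (∀ u ∈ D, ∀ v ∈ D, ∃ p : G.Walk u v, ∀ x ∈ p.support, x ∉ K) ∧
  (∀ u ∈ D, ∀ v : V, v ∉ K → (∃ p : G.Walk u v, ∀ x ∈ p.support, x ∉ K) → v ∈ D)

/-- A deep component of `G \ K`: not contained in any bounded neighborhood of `K`. -/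
def IsDeepComponent {V : Type*} (G : SimpleGraph V) (K D : Set V) : Prop :=
  ComponentAvoiding G K D ∧ ∀ r : ℕ, ¬ D ⊆ {v | ∃ k ∈ K, G.dist k v ≤ r}

/-- An unbounded component of `G \ K`. -/
def IsUnboundedComponent {V : Type*} (G : SimpleGraph V) (K D : Set V) : Prop :=
  ComponentAvoiding G K D ∧ ∀ (v : V) (r : ℕ), ¬ D ⊆ {u | G.dist v u ≤ r}

/-- Uniformly locally finite graph: vertex degrees are bounded. -/
def UnifLocFinite {V : Type*} (G : SimpleGraph V) : Prop :=
  ∃ M : ℕ, ∀ v : V, (G.neighborSet v).Finite ∧ (G.neighborSet v).ncard ≤ M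

/-- Locally finite graph. -/
def LocFinite {V : Type*} (G : SimpleGraph V) : Prop := ∀ v : V, (G.neighborSet v).Finite

/-- A `c`-quasi-isometry between two connected graphs (with their path-metrics). -/
def GraphQI {V V' : Type*} (c : ℝ) (G : SimpleGraph V) (H : SimpleGraph V') (φ : V → V') : Prop :=
  1 ≤ c ∧
  (∀ a b : V, (G.dist a b : ℝ) / c - c ≤ (H.dist (φ a) (φ b) : ℝ) ∧
    (H.dist (φ a) (φ b) : ℝ) ≤ c * (G.dist a b : ℝ) + c) ∧
  (∀ y : V', ∃ x : V, (H.dist (φ x) y : ℝ) ≤ c)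

/-- The Cayley graph of a group with respect to a set `S`. -/
def cayley (G : Type) [Group G] (S : Set G) : SimpleGraph G :=
  SimpleGraph.fromRel (fun a b => a⁻¹ * b ∈ S)

/-- `S` is a finite generating set. -/
def IsFiniteGenSet {G : Type} [Group G] (S : Set G) : Prop :=
  S.Finite ∧ Subgroup.closure S = ⊤

/-- The ball of radius `n` around the identity for the word metric w.r.t. `T`. -/
def wordBall {G : Type} [Group G] (T : Set G) (n : ℕ) : Set G :=
  {g | ∃ l : List G, (∀ x ∈ l, x ∈ T ∨ x⁻¹ ∈ T) ∧ l.length ≤ n ∧ l.prod = g}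

/-- The word metric w.r.t. `T`. -/
noncomputable def wordDist {G : Type} [Group G] (T : Set G) (x y : G) : ℕ :=
  sInf {n | x⁻¹ * y ∈ wordBall T n}

/-- `G` is an amalgamated product `A ∗_C B` with `C` a proper subgroup of both factors,
where `C` corresponds to the given subgroup. -/
def SplitsOverAmalgam (G : Type) [Group G] (C : Subgroup G) : Prop :=
  ∃ (Gi : Bool → Type) (_ : ∀ i, Group (Gi i)) (K : Type) (_ : Group K)
    (φ : ∀ i, K →* Gi i),
    (∀ i, Function.Injective (φ i)) ∧ (∀ i, ¬ Function.Surjective (φ i)) ∧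
    ∃ e : G ≃* Monoid.PushoutI φ,
      C = Subgroup.comap e.toMonoidHom (Monoid.PushoutI.base φ).range

/-- `G` is an HNN-extension over the given subgroup `C`. -/
def SplitsOverHNN (G : Type) [Group G] (C : Subgroup G) : Prop :=
  ∃ (H : Type) (_ : Group H) (A B : Subgroup H) (φ : A ≃* B)
    (e : G ≃* HNNExtension H A B φ),
    C = Subgroup.comap e.toMonoidHom
      (Subgroup.map (HNNExtension.of : H →* HNNExtension H A B φ) A)

/-- `G` splits over `C`: amalgamated product with `C` proper in both factors,
or HNN-extension over `C`. -/
def SplitsOver (G : Type) [Group G] (C : Subgroup G) : Prop :=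
  SplitsOverAmalgam G C ∨ SplitsOverHNN G C

/-- Amenability of a (discrete) group: existence of a left-invariant, finitely
additive probability measure defined on all subsets. -/
def IsAmenable (G : Type) [Group G] : Prop :=
  ∃ m : Set G → ℝ, (∀ A : Set G, 0 ≤ m A) ∧ m Set.univ = 1 ∧
    (∀ A B : Set G, Disjoint A B → m (A ∪ B) = m A + m B) ∧
    (∀ (g : G) (A : Set G), m ((g * ·) '' A) = m A)


open MeasureTheory in
/-- A finite set of lattice points meeting every axis-parallel line through a point of `A` has at
least `#A ^ ((k - 1) / k)` elements, where `k = e + 2` is the dimension. -/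
theorem card_pow_le_of_meets_lines {e : ℕ} (A B : Finset (Fin (e + 2) → ℤ))
    (h : ∀ x ∈ A, ∀ i, ∃ t, Function.update x i t ∈ B) :
    A.card ^ (e + 1) ≤ B.card ^ (e + 2) := by
  classical
  have hcard : ∀ C : Finset (Fin (e + 2) → ℤ),
      (Measure.pi fun _ : Fin (e + 2) => (Measure.count : Measure ℤ)) C = C.card := by
    intro C
    rw [← sum_measure_singleton]
    simp [Measure.pi_singleton]
  have hp : Real.HolderConjugate (Fintype.card (Fin (e + 2)) : ℝ) ((e + 2 : ℝ) / (e + 1)) := by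
    rw [Real.holderConjugate_iff]
    refine ⟨by rw [Fintype.card_fin]; exact_mod_cast Nat.one_lt_succ_succ e, ?_⟩
    simp only [Fintype.card_fin]
    push_cast
    field_simp
    ring
  have key := lintegral_prod_lintegral_pow_le (fun _ : Fin (e + 2) => (Measure.count : Measure ℤ))
    hp (f := (B : Set (Fin (e + 2) → ℤ)).indicator 1) (measurable_of_countable _)
  rw [lintegral_indicator_one B.measurableSet, hcard] at key
  have hA : (A.card : ENNReal) ≤ (B.card : ENNReal) ^ ((e + 2 : ℝ) / (e + 1)) := by
    refine le_trans ?_ key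
    rw [← hcard, ← lintegral_indicator_one A.measurableSet]
    refine lintegral_mono fun x => ?_
    by_cases hx : x ∈ A
    · rw [Set.indicator_of_mem (by simpa using hx)]
      refine Finset.one_le_prod' fun i _ => ?_
      have he : (0 : ℝ) < 1 / ((Fintype.card (Fin (e + 2)) : ℝ) - 1) := by
        rw [Fintype.card_fin]
        push_cast
        exact one_div_pos.2 (by linarith [(Nat.cast_nonneg e : (0 : ℝ) ≤ e)])
      refine ENNReal.one_le_rpow ?_ he
      obtain ⟨t, ht⟩ := h x hx i
      calc (1 : ENNReal)
          = (B : Set (Fin (e + 2) → ℤ)).indicator 1 (Function.update x i t) := by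
            rw [Set.indicator_of_mem (by simpa using ht)]; rfl
        _ ≤ _ := by
            rw [lintegral_count]
            exact ENNReal.le_tsum (f := fun s : ℤ =>
              (B : Set (Fin (e + 2) → ℤ)).indicator (1 : (Fin (e + 2) → ℤ) → ENNReal) (Function.update x i s)) t
    · rw [Set.indicator_of_notMem (by simpa using hx)]
      exact zero_le
  have h2 := ENNReal.rpow_le_rpow hA (z := (e + 1 : ℝ)) (by positivity)
  rw [← ENNReal.rpow_mul, div_mul_cancel₀ _ (by positivity)] at h2
  have e1 : (e + 1 : ℝ) = ((e + 1 : ℕ) : ℝ) := by push_cast; ring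
  have e2 : (e + 2 : ℝ) = ((e + 2 : ℕ) : ℝ) := by push_cast; ring
  rw [e1, e2, ENNReal.rpow_natCast, ENNReal.rpow_natCast] at h2
  exact_mod_cast h2

/-- Discrete isoperimetric inequality for the unit steps in the positive coordinate directions. -/
theorem card_pow_le_of_shifts_subset {e : ℕ} (A D : Finset (Fin (e + 2) → ℤ))
    (h : ∀ x ∈ A, ∀ i, x + Pi.single i 1 ∈ D) :
    A.card ^ (e + 1) ≤ (D \ A).card ^ (e + 2) := by
  classical
  refine card_pow_le_of_meets_lines A (D \ A) fun x hx i => ?_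
  have hex : ∃ n : ℕ, x + Pi.single i (n : ℤ) ∉ A := by
    by_contra! hall
    refine Set.infinite_of_injective_forall_mem (f := fun n : ℕ => x + Pi.single i (n : ℤ)) ?_
      (s := (A : Set (Fin (e + 2) → ℤ))) (by simpa using hall) A.finite_toSet
    intro a b hab
    simpa using congrFun hab i
  obtain ⟨n, hn, hmin⟩ : ∃ n : ℕ, x + Pi.single i (n : ℤ) ∉ A ∧
      ∀ m < n, x + Pi.single i (m : ℤ) ∈ A :=
    ⟨Nat.find hex, Nat.find_spec hex, fun m hm => by simpa using Nat.find_min hex hm⟩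
  obtain _ | n := n
  · simp [hx] at hn
  refine ⟨x i + (n + 1 : ℕ), ?_⟩
  have hup : Function.update x i (x i + (n + 1 : ℕ)) = x + Pi.single i ((n + 1 : ℕ) : ℤ) := by
    ext j
    by_cases hj : j = i
    · subst hj; simp
    · simp [hj]
  rw [hup, Finset.mem_sdiff]
  refine ⟨?_, hn⟩
  have := h _ (hmin n (Nat.lt_succ_self n)) i
  rwa [add_assoc, ← Pi.single_add, ← Nat.cast_succ] at this

/-- A sequence with isoperimetric growth in dimension `e + 2`, started large enough, survives
cumulative losses of order `n ^ (e + 1)`. -/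
theorem pos_of_isoperimetric_growth {e K : ℕ} {a b w : ℕ → ℕ} {q R : ℕ}
    (hq : q = (e + 2) * 2 ^ (e + 2)) (hR : R = K * q ^ (e + 2) + 1)
    (h0 : R ^ (e + 2) ≤ a 0)
    (hstep : ∀ n, a n + b n ≤ a (n + 1) + w (n + 1))
    (hiso : ∀ n, a n ^ (e + 1) ≤ b n ^ (e + 2))
    (hw : ∀ n, ∑ j ∈ Finset.range (n + 1), w j ≤ K * n ^ (e + 1)) (n : ℕ) :
    0 < a n := by
  have hq2 : 2 ≤ q := by
    rw [hq]
    nlinarith [Nat.one_le_two_pow (n := e + 2)]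
  have main : ∀ n, 2 * (R + n) ^ (e + 2) ≤
      q ^ (e + 2) * (a n + ∑ j ∈ Finset.range (n + 1), w j) →
      (R + n) ^ (e + 2) ≤ q ^ (e + 2) * a n := by
    intro n h
    have h1 : q ^ (e + 2) * ∑ j ∈ Finset.range (n + 1), w j ≤ (R + n) ^ (e + 2) := by
      calc q ^ (e + 2) * ∑ j ∈ Finset.range (n + 1), w j
          ≤ q ^ (e + 2) * (K * n ^ (e + 1)) := Nat.mul_le_mul_left _ (hw n)
        _ = (K * q ^ (e + 2)) * n ^ (e + 1) := by ring
        _ ≤ (R + n) * (R + n) ^ (e + 1) := by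
            gcongr
            · omega
            · omega
        _ = _ := by ring
    rw [mul_add] at h
    omega
  have claim : ∀ n, 2 * (R + n) ^ (e + 2) ≤
      q ^ (e + 2) * (a n + ∑ j ∈ Finset.range (n + 1), w j) := by
    intro n
    induction n with
    | zero =>
      have : 2 ≤ q ^ (e + 2) := hq2.trans (Nat.le_self_pow (by omega) q)
      calc 2 * (R + 0) ^ (e + 2) ≤ q ^ (e + 2) * a 0 := Nat.mul_le_mul this h0
        _ ≤ _ := by gcongr; omega
    | succ n ih =>
      have h1 := main n ih
      have h2 : (R + n) ^ (e + 1) ≤ q ^ (e + 1) * b n := by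
        refine le_of_pow_le_pow_left₀ (n := e + 2) (by omega) (Nat.zero_le _) ?_
        calc ((R + n) ^ (e + 1)) ^ (e + 2) = ((R + n) ^ (e + 2)) ^ (e + 1) := pow_right_comm ..
          _ ≤ (q ^ (e + 2) * a n) ^ (e + 1) := by gcongr
          _ = (q ^ (e + 1)) ^ (e + 2) * a n ^ (e + 1) := by rw [mul_pow]; ring
          _ ≤ (q ^ (e + 1)) ^ (e + 2) * b n ^ (e + 2) := Nat.mul_le_mul_left _ (hiso n)
          _ = _ := by ring
      have hpow : (R + n + 1) ^ (e + 2) ≤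
          (R + n) ^ (e + 2) + (e + 2) * (R + n + 1) ^ (e + 1) := by
        have := abs_pow_sub_pow_le ((R + n + 1 : ℕ) : ℤ) ((R + n : ℕ) : ℤ) (e + 2)
        rw [max_eq_left (by push_cast; rw [abs_of_nonneg, abs_of_nonneg] <;> omega)] at this
        have h3 := (le_abs_self _).trans this
        rw [abs_of_nonneg (Int.natCast_nonneg (R + n + 1))] at h3
        simp only [Nat.cast_add, Nat.cast_one, add_sub_cancel_left, abs_one, one_mul,
          Nat.add_succ_sub_one] at h3
        zify
        push_cast at h3
        linarith
      have hbig : (R + n + 1) ^ (e + 1) ≤ 2 ^ (e + 1) * (R + n) ^ (e + 1) := by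
        rw [← mul_pow]
        gcongr
        omega
      have hstep' := hstep n
      rw [Finset.sum_range_succ]
      calc 2 * (R + (n + 1)) ^ (e + 2)
          ≤ 2 * ((R + n) ^ (e + 2) + (e + 2) * (2 ^ (e + 1) * (R + n) ^ (e + 1))) := by
            rw [← add_assoc]
            gcongr
            exact hpow.trans (by gcongr)
        _ = 2 * (R + n) ^ (e + 2) + q * (R + n) ^ (e + 1) := by rw [hq]; ring
        _ ≤ q ^ (e + 2) * (a n + ∑ j ∈ Finset.range (n + 1), w j) + q * (q ^ (e + 1) * b n) := by
            gcongr
        _ = q ^ (e + 2) * ((a n + b n) + ∑ j ∈ Finset.range (n + 1), w j) := by ring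
        _ ≤ q ^ (e + 2) * ((a (n + 1) + w (n + 1)) + ∑ j ∈ Finset.range (n + 1), w j) := by
            gcongr
        _ = _ := by ring
  have h := main n (claim n)
  by_contra h0
  have hpos : 0 < (R + n) ^ (e + 2) := Nat.pow_pos (by omega)
  have hz : a n = 0 := by omega
  rw [hz] at h
  omega

section Fire

variable {V : Type*} {G : SimpleGraph V} {W : ℕ → Set V} {X0 : Set V}

/-- One time step of a fire of reach one. -/
theorem mem_fireSet_one_succ {n : ℕ} {v : V} :
    v ∈ fireSet G 1 W X0 (n + 1) ↔ v ∈ fireSet G 1 W X0 n ∨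
      (v ∉ protectedUpTo W (n + 1) ∧ ∃ u ∈ fireSet G 1 W X0 n, G.Adj u v) := by
  rw [fireSet, Set.mem_ofPred_eq]
  constructor
  · rintro ⟨u, hu, p, hp, hs⟩
    by_cases hv : v ∈ fireSet G 1 W X0 n
    · exact Or.inl hv
    refine Or.inr ⟨fun hW => hs v p.end_mem_support ⟨hW, hv⟩, u, hu, ?_⟩
    rcases Nat.le_one_iff_eq_zero_or_eq_one.1 hp with h | h
    · exact absurd (SimpleGraph.Walk.eq_of_length_eq_zero h ▸ hu) hv
    · exact SimpleGraph.Walk.adj_of_length_eq_one h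
  · rintro (hv | ⟨hv, u, hu, huv⟩)
    · exact ⟨v, hv, SimpleGraph.Walk.nil, by simp, by simp [hv]⟩
    · refine ⟨u, hu, huv.toWalk, by simp, fun x hx => ?_⟩
      simp only [SimpleGraph.Walk.support_cons, SimpleGraph.Walk.support_nil,
        List.mem_cons, List.not_mem_nil, or_false] at hx
      rcases hx with rfl | rfl
      · exact fun h => h.2 hu
      · exact fun h => hv h.1

theorem protectedUpTo_mono (W : ℕ → Set V) : Monotone (protectedUpTo W) := fun m n h =>
  Set.biUnion_subset_biUnion_left fun i hi => by
    simp only [SetLike.mem_coe, Finset.mem_Icc] at hi ⊢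
    omega

theorem protectedUpTo_finite {f : ℕ → ℕ} (hW : IsStrategyBound f W) (n : ℕ) :
    (protectedUpTo W n).Finite :=
  (Finset.Icc 1 n).finite_toSet.biUnion fun i hi => (hW i (Finset.mem_Icc.1 hi).1).1

theorem ncard_protectedUpTo_le {f : ℕ → ℕ} (hW : IsStrategyBound f W) (n : ℕ) :
    (protectedUpTo W n).ncard ≤ ∑ i ∈ Finset.Icc 1 n, f i :=
  (Finset.set_ncard_biUnion_le _ _).trans
    (Finset.sum_le_sum fun i hi => (hW i (Finset.mem_Icc.1 hi).1).2)

/-- If the layers `φ n`, for `n : ℕ`, are disjoint copies of the lattice of rank `e + 2` in `G`, and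
each layer is joined to the next one by the origin and the unit vectors, then some finite initial
fire escapes every strategy of polynomial degree `e` with leading constant `K`. -/
theorem exists_burnedSet_infinite {e : ℕ} (φ : ℕ → (Fin (e + 2) → ℤ) → V)
    (hinj : ∀ n y n' y', φ n y = φ n' y' → n = n' ∧ y = y')
    (hadj0 : ∀ n y, G.Adj (φ n y) (φ (n + 1) y))
    (hadj1 : ∀ n y i, G.Adj (φ n y) (φ (n + 1) (y + Pi.single i 1))) (K : ℕ) :
    ∃ X0 : Set V, X0.Finite ∧ ∀ W, IsStrategyBound (fun n => K * n ^ e) W →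
      (burnedSet G 1 W X0).Infinite := by
  classical
  have hφ : ∀ n, Function.Injective (φ n) := fun n y y' h => (hinj _ _ _ _ h).2
  obtain ⟨q, hq⟩ : ∃ q, q = (e + 2) * 2 ^ (e + 2) := ⟨_, rfl⟩
  obtain ⟨R, hR⟩ : ∃ R, R = K * q ^ (e + 2) + 1 := ⟨_, rfl⟩
  let Q : Finset (Fin (e + 2) → ℤ) := Fintype.piFinset fun _ => Finset.Ico 0 (R : ℤ)
  refine ⟨Q.image (φ 0), Finset.finite_toSet _, fun W hW hfin => ?_⟩
  set X0 : Set V := ((Q.image (φ 0) : Finset V) : Set V) with hX0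
  have hXfin : ∀ n, (fireSet G 1 W X0 n).Finite := fun n =>
    hfin.subset (Set.subset_iUnion (fireSet G 1 W X0) n)
  have hPfin := protectedUpTo_finite hW
  let A : ℕ → Finset (Fin (e + 2) → ℤ) := fun n =>
    ((hXfin n).preimage (hφ n).injOn).toFinset
  let P : ℕ → Finset (Fin (e + 2) → ℤ) := fun n =>
    ((hPfin n).preimage (hφ n).injOn).toFinset
  have memA : ∀ n y, y ∈ A n ↔ φ n y ∈ fireSet G 1 W X0 n := fun n y => by simp [A]
  have memP : ∀ n y, y ∈ P n ↔ φ n y ∈ protectedUpTo W n := fun n y => by simp [P]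
  have hpos : ∀ n, 0 < (A n).card := by
    refine pos_of_isoperimetric_growth (b := fun n => ((A (n + 1) ∪ P (n + 1)) \ A n).card)
      (w := fun n => (P n).card) hq hR ?_ (fun n => ?_) (fun n => ?_) (fun n => ?_)
    · have hQ : Q.card = R ^ (e + 2) := by simp [Q]
      rw [← hQ]
      refine Finset.card_le_card fun y hy => ?_
      rw [memA, fireSet, hX0]
      exact Finset.mem_coe.2 (Finset.mem_image_of_mem _ hy)
    · have hsub : A n ⊆ A (n + 1) ∪ P (n + 1) := by
        intro y hy
        rw [Finset.mem_union, memA, memP, mem_fireSet_one_succ]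
        rw [memA] at hy
        have hex : ∃ u ∈ fireSet G 1 W X0 n, G.Adj u (φ (n + 1) y) := ⟨_, hy, hadj0 n y⟩
        rcases em (φ (n + 1) y ∈ protectedUpTo W (n + 1)) with h | h
        exacts [Or.inr h, Or.inl (Or.inr ⟨h, hex⟩)]
      rw [add_comm, Finset.card_sdiff_add_card_eq_card hsub]
      exact Finset.card_union_le _ _
    · refine card_pow_le_of_shifts_subset _ _ fun y hy i => ?_
      rw [Finset.mem_union, memA, memP, mem_fireSet_one_succ]
      rw [memA] at hy
      have hex : ∃ u ∈ fireSet G 1 W X0 n, G.Adj u (φ (n + 1) (y + Pi.single i 1)) :=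
        ⟨_, hy, hadj1 n y i⟩
      rcases em (φ (n + 1) (y + Pi.single i 1) ∈ protectedUpTo W (n + 1)) with h | h
      exacts [Or.inr h, Or.inl (Or.inr ⟨h, hex⟩)]
    · rw [← Finset.card_sigma]
      calc _ ≤ (hPfin n).toFinset.card := by
            refine Finset.card_le_card_of_injOn (fun p => φ p.1 p.2) ?_ ?_
            · rintro ⟨j, y⟩ hj
              simp only [Finset.mem_coe, Finset.mem_sigma, Finset.mem_range, memP] at hj
              simpa using protectedUpTo_mono W (Nat.lt_succ_iff.1 hj.1) hj.2
            · rintro ⟨j, y⟩ - ⟨j', y'⟩ - h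
              obtain ⟨rfl, rfl⟩ := hinj _ _ _ _ h
              rfl
        _ = (protectedUpTo W n).ncard := (Set.ncard_eq_toFinset_card _ (hPfin n)).symm
        _ ≤ ∑ i ∈ Finset.Icc 1 n, K * i ^ e := ncard_protectedUpTo_le hW n
        _ ≤ ∑ i ∈ Finset.Icc 1 n, K * n ^ e := by
            refine Finset.sum_le_sum fun i hi => ?_
            have := (Finset.mem_Icc.1 hi).2
            gcongr
        _ = K * n ^ (e + 1) := by simp; ring
  choose y hy using fun n => Finset.card_pos.1 (hpos n)
  refine Set.infinite_of_injective_forall_mem (f := fun n => φ n (y n))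
    (fun m n h => (hinj _ _ _ _ h).1) (fun n => ?_) hfin
  exact Set.mem_iUnion.2 ⟨n, (memA n _).1 (hy n)⟩

/-- A finite set can be protected within time `N` as soon as the total budget allows it. -/
theorem exists_strategy_of_card_le (f : ℕ → ℕ) (N : ℕ) (F : Finset V)
    (h : F.card ≤ ∑ i ∈ Finset.Icc 1 N, f i) :
    ∃ W : ℕ → Set V, IsStrategyBound f W ∧ (∀ n, N < n → W n = ∅) ∧
      (F : Set V) ⊆ protectedUpTo W N := by
  classical
  induction N generalizing F with
  | zero =>
    obtain rfl : F = ∅ := by simpa using h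
    exact ⟨fun _ => ∅, fun n _ => by simp, by simp, by simp⟩
  | succ N ih =>
    rw [Finset.sum_Icc_succ_top (by omega)] at h
    obtain ⟨T, hT, hTc⟩ := Finset.exists_subset_card_eq (min_le_left F.card (f (N + 1)))
    obtain ⟨W, hW, hW0, hF⟩ := ih (F \ T) (by
      rw [Finset.card_sdiff_of_subset hT, hTc]
      omega)
    refine ⟨Function.update W (N + 1) T, fun n hn => ?_, fun n hn => ?_, fun x hx => ?_⟩
    · by_cases hnN : n = N + 1
      · subst hnN
        simp only [Function.update_self]
        exact ⟨T.finite_toSet, by rw [Set.ncard_coe_finset]; omega⟩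
      · rw [Function.update_of_ne hnN]
        exact hW n hn
    · rw [Function.update_of_ne (by omega)]
      exact hW0 n (by omega)
    · simp only [protectedUpTo, Set.mem_iUnion, exists_prop]
      by_cases hxT : x ∈ T
      · exact ⟨N + 1, by simp, by simpa using hxT⟩
      · have := hF (a := x) (by simpa [hxT] using hx)
        simp only [protectedUpTo, Set.mem_iUnion, exists_prop] at this
        obtain ⟨i, hi, hxi⟩ := this
        rw [Finset.mem_Icc] at hi
        refine ⟨i, by rw [Finset.mem_Icc]; omega, ?_⟩
        rwa [Function.update_of_ne (by omega)]

end Fire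

section Growth

variable {V : Type*} {G : SimpleGraph V}

theorem finite_setOf_dist_le (hG : G.Connected) (hfin : ∀ v, (G.neighborSet v).Finite) (u : V)
    (n : ℕ) : {v | G.dist u v ≤ n}.Finite := by
  induction n with
  | zero =>
    refine (Set.finite_singleton u).subset fun v hv => ?_
    have h0 : G.dist u v = 0 := Nat.le_zero.1 hv
    exact (hG.dist_eq_zero_iff.1 h0).symm
  | succ n ih =>
    refine (ih.union (ih.biUnion fun w _ => hfin w)).subset fun v hv => ?_
    obtain ⟨p, hp⟩ := hG.exists_walk_length_eq_dist v u
    rw [SimpleGraph.dist_comm] at hp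
    cases p with
    | nil => exact Or.inl (by simp)
    | cons h p =>
      rename_i w
      refine Or.inr (Set.mem_biUnion (x := w) ?_ h.symm)
      have := SimpleGraph.dist_le p
      rw [SimpleGraph.Walk.length_cons] at hp
      rw [Set.mem_ofPred_eq] at hv ⊢
      rw [SimpleGraph.dist_comm]
      omega

/-- The complement of a finite set of vertices has the growth of the whole graph. -/
theorem growthEqFull_compl_of_finite [Infinite V] (hG : G.Connected)
    (hfin : ∀ v, (G.neighborSet v).Finite) {X : Set V} (hX : X.Finite) : GrowthEqFull G Xᶜ := by
  obtain ⟨u₀, hu₀⟩ := hX.exists_notMem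
  have hball := finite_setOf_dist_le hG hfin u₀
  have hsub : ∀ n, {v | v ∈ Xᶜ ∧ ∃ a ∈ ({u₀} : Set V), G.dist a v ≤ n} ⊆ {v | G.dist u₀ v ≤ n} := by
    rintro n v ⟨-, a, rfl, h⟩
    exact h
  have hmono : ∀ m n, m ≤ n → ∀ U : Set V, graphGrowth G U {u₀} m ≤ graphGrowth G U {u₀} n := by
    intro m n hmn U
    refine Set.ncard_le_ncard ?_ ((hball n).subset ?_)
    · rintro v ⟨hv, a, ha, h⟩
      exact ⟨hv, a, ha, h.trans hmn⟩
    · rintro v ⟨-, a, rfl, h⟩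
      exact h
  refine ⟨u₀, hu₀, ⟨X.ncard + 1, by omega, fun n => ?_⟩, 1, one_pos, fun n => ?_⟩
  · have h1 : graphGrowth G Set.univ {u₀} n ≤ graphGrowth G Xᶜ {u₀} n + X.ncard := by
      refine (Set.ncard_le_ncard ?_ (((hball n).subset (hsub n)).union hX)).trans
        (Set.ncard_union_le _ _)
      rintro v ⟨-, h⟩
      by_cases hv : v ∈ X
      · exact Or.inr hv
      · exact Or.inl ⟨hv, h⟩
    have h2 := hmono n ((X.ncard + 1) * n + (X.ncard + 1)) (by nlinarith) Xᶜ
    nlinarith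
  · have h1 : graphGrowth G Xᶜ {u₀} n ≤ graphGrowth G Set.univ {u₀} n := by
      refine Set.ncard_le_ncard ?_ ((hball n).subset ?_)
      · rintro v ⟨-, h⟩
        exact ⟨trivial, h⟩
      · rintro v ⟨-, a, rfl, h⟩
        exact h
    have h2 := hmono n (1 * n + 1) (by omega) Set.univ
    omega

/-- In an infinite connected locally finite graph, a set with full growth is infinite. -/
theorem GrowthEqFull.infinite [Infinite V] (hG : G.Connected)
    (hfin : ∀ v, (G.neighborSet v).Finite) {U : Set V} (hU : GrowthEqFull G U) : U.Infinite := by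
  intro hUfin
  obtain ⟨u₀, -, ⟨C, -, hC⟩, -⟩ := hU
  obtain ⟨T, hT⟩ := Infinite.exists_subset_card_eq V (C * U.ncard + C + 1)
  have h1 : T.card ≤ graphGrowth G Set.univ {u₀} (T.sup fun v => G.dist u₀ v) := by
    rw [← Set.ncard_coe_finset]
    refine Set.ncard_le_ncard (fun v hv => ⟨trivial, u₀, rfl, ?_⟩)
      ((finite_setOf_dist_le hG hfin u₀ (T.sup fun v => G.dist u₀ v)).subset ?_)
    · exact Finset.le_sup (f := fun v => G.dist u₀ v) hv
    · rintro v ⟨-, a, rfl, h⟩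
      exact h
  have h2 := hC (T.sup fun v => G.dist u₀ v)
  have h3 : graphGrowth G U {u₀} (C * (T.sup fun v => G.dist u₀ v) + C) ≤ U.ncard :=
    Set.ncard_le_ncard (fun v hv => hv.1) hUfin
  have h4 := Nat.mul_le_mul_left C h3
  omega

end Growth

section Cayley

variable {G : Type} [Group G] {S : Set G}

theorem cayley_adj {a b : G} :
    (cayley G S).Adj a b ↔ a ≠ b ∧ (a⁻¹ * b ∈ S ∨ b⁻¹ * a ∈ S) :=
  SimpleGraph.fromRel_adj ..

theorem cayley_neighborSet_finite (hS : S.Finite) (v : G) :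
    ((cayley G S).neighborSet v).Finite := by
  refine ((hS.image fun s => v * s).union (hS.image fun s => v * s⁻¹)).subset fun w hw => ?_
  rcases (cayley_adj.1 hw).2 with h | h
  · exact Or.inl ⟨_, h, by group⟩
  · exact Or.inr ⟨_, h, by group⟩

/-- A set of vertices which is closed under adjacency away from `F` is invariant under right
translation by `g` away from finitely many translates of `F`. -/
theorem exists_finite_forall_mem_iff_mul_mem {B F : Set G}
    (hB : ∀ u ∈ B, ∀ v, (cayley G S).Adj u v → v ∉ F → v ∈ B) {g : G}
    (hg : g ∈ Subgroup.closure S) :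
    ∃ D : Set G, D.Finite ∧ ∀ u, (∀ x ∈ D, u * x ∉ F) → (u ∈ B ↔ u * g ∈ B) := by
  induction hg using Subgroup.closure_induction with
  | mem s hs =>
    refine ⟨{1, s}, by simp, fun u hu => ?_⟩
    by_cases h1 : s = 1
    · simp [h1]
    have hadj : (cayley G S).Adj u (u * s) := cayley_adj.2 ⟨by simpa using h1, by simp [hs]⟩
    exact ⟨fun h => hB _ h _ hadj (hu s (by simp)),
      fun h => hB _ h _ hadj.symm (by simpa using hu 1 (by simp))⟩
  | one => exact ⟨∅, Set.finite_empty, by simp⟩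
  | mul x y _ _ hx hy =>
    obtain ⟨D, hD, h⟩ := hx
    obtain ⟨D', hD', h'⟩ := hy
    refine ⟨D ∪ (fun z => x * z) '' D', hD.union (hD'.image _), fun u hu => ?_⟩
    rw [h u fun z hz => hu z (Or.inl hz), ← mul_assoc]
    refine h' _ fun z hz => ?_
    rw [mul_assoc]
    exact hu _ (Or.inr ⟨z, hz, rfl⟩)
  | inv x _ hx =>
    obtain ⟨D, hD, h⟩ := hx
    refine ⟨(fun z => x⁻¹ * z) '' D, hD.image _, fun u hu => ?_⟩
    have := h (u * x⁻¹) fun z hz => by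
      rw [mul_assoc]
      exact hu _ ⟨z, hz, rfl⟩
    rw [this, inv_mul_cancel_right]

theorem cayley_connected (hS : Subgroup.closure S = ⊤) : (cayley G S).Connected := by
  have key : ∀ v, (cayley G S).Reachable 1 v := by
    intro v
    obtain ⟨D, -, h⟩ := exists_finite_forall_mem_iff_mul_mem (S := S)
      (B := {v | (cayley G S).Reachable 1 v}) (F := ∅)
      (fun u hu v huv _ => hu.trans huv.reachable) (g := v) (hS ▸ Subgroup.mem_top v)
    simpa using (h 1 (by simp)).1 (SimpleGraph.Reachable.refl (G := cayley G S) 1)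
  exact SimpleGraph.connected_iff _ |>.2 ⟨fun u v => (key u).symm.trans (key v), ⟨1⟩⟩

end Cayley

section Lattice

variable {m : ℕ}

/-- The lattice points with all coordinates of absolute value at most `M`. -/
noncomputable def latticeBox (m M : ℕ) : Finset (Multiplicative (Fin m → ℤ)) :=
  (Fintype.piFinset fun _ : Fin m => Finset.Icc (-(M : ℤ)) M).map Multiplicative.ofAdd.toEmbedding

theorem mem_latticeBox {M : ℕ} {x : Multiplicative (Fin m → ℤ)} :
    x ∈ latticeBox m M ↔ ∀ i, |x.toAdd i| ≤ M := by
  simp only [latticeBox, Finset.mem_map_equiv, Fintype.mem_piFinset, Finset.mem_Icc, abs_le]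
  rfl

theorem card_latticeBox (m M : ℕ) : (latticeBox m M).card = (2 * M + 1) ^ m := by
  rw [latticeBox, Finset.card_map, Fintype.card_piFinset]
  simp only [Int.card_Icc, Finset.prod_const, Finset.card_univ, Fintype.card_fin]
  congr 1
  omega

theorem latticeBox_mono (m : ℕ) {M N : ℕ} (h : M ≤ N) : latticeBox m M ⊆ latticeBox m N :=
  fun x hx => mem_latticeBox.2 fun i => (mem_latticeBox.1 hx i).trans (by exact_mod_cast h)

theorem exists_subset_latticeBox {X : Set (Multiplicative (Fin m → ℤ))} (hX : X.Finite) :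
    ∃ M : ℕ, X ⊆ latticeBox m M := by
  refine ⟨hX.toFinset.sup fun x => Finset.univ.sup fun i => (x.toAdd i).natAbs, fun x hx => ?_⟩
  refine Finset.mem_coe.2 (mem_latticeBox.2 fun i => ?_)
  rw [Int.abs_eq_natAbs]
  have h1 : (x.toAdd i).natAbs ≤ Finset.univ.sup fun i => (x.toAdd i).natAbs :=
    Finset.le_sup (f := fun i => (x.toAdd i).natAbs) (Finset.mem_univ i)
  have h2 := Finset.le_sup (f := fun x : Multiplicative (Fin m → ℤ) =>
    Finset.univ.sup fun i => (x.toAdd i).natAbs) (hX.mem_toFinset.2 hx)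
  exact_mod_cast h1.trans h2

/-- In rank at least two, an infinite set of lattice points which is invariant under unit
translations outside a finite set is cofinite. -/
theorem finite_compl_of_unit_invariant [Nontrivial (Fin m)] {B : Set (Multiplicative (Fin m → ℤ))}
    (hB : B.Infinite) {E : Set (Multiplicative (Fin m → ℤ))} (hE : E.Finite)
    (h : ∀ i, ∀ u ∉ E, u ∈ B ↔ u * Multiplicative.ofAdd (Pi.single i 1) ∈ B) : Bᶜ.Finite := by
  obtain ⟨M, hM⟩ := exists_subset_latticeBox hE
  have hnot : ∀ (u : Fin m → ℤ) (j : Fin m), (M : ℤ) < |u j| → Multiplicative.ofAdd u ∉ E :=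
    fun u j hj hu => absurd (mem_latticeBox.1 (hM hu) j) (not_le.2 hj)
  have hmove : ∀ (u : Fin m → ℤ) (i j : Fin m), i ≠ j → (M : ℤ) < |u j| → ∀ t,
      (Multiplicative.ofAdd u ∈ B ↔ Multiplicative.ofAdd (Function.update u i t) ∈ B) := by
    intro u i j hij hj
    have hstep : ∀ t : ℤ, Multiplicative.ofAdd (Function.update u i t) ∈ B ↔
        Multiplicative.ofAdd (Function.update u i (t + 1)) ∈ B := by
      intro t
      rw [h i _ (hnot (Function.update u i t) j (by rwa [Function.update_of_ne hij.symm])),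
        ← ofAdd_add]
      have : Function.update u i t + Pi.single i 1 = Function.update u i (t + 1) := by
        ext l
        by_cases hl : l = i
        · subst hl; simp
        · simp [hl]
      rw [this]
    have hall : ∀ t : ℤ, Multiplicative.ofAdd (Function.update u i 0) ∈ B ↔
        Multiplicative.ofAdd (Function.update u i t) ∈ B := by
      intro t
      induction t using Int.induction_on with
      | zero => rfl
      | succ n ih => rw [ih, hstep]
      | pred n ih => rw [ih, hstep (-(n : ℤ) - 1), sub_add_cancel]
    intro t
    rw [← hall t, hall (u i), Function.update_eq_self]
  let c : Fin m → ℤ := fun _ => M + 1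
  have hMc : (M : ℤ) < |(M : ℤ) + 1| := by rw [abs_of_nonneg (by omega)]; omega
  have hcanon : ∀ (u : Fin m → ℤ) (i : Fin m), u i = M + 1 →
      (Multiplicative.ofAdd u ∈ B ↔ Multiplicative.ofAdd c ∈ B) := by
    intro u i hi
    have hs : ∀ s : Finset (Fin m),
        (Multiplicative.ofAdd u ∈ B ↔ Multiplicative.ofAdd (s.piecewise c u) ∈ B) := by
      intro s
      induction s using Finset.induction_on with
      | empty => simp
      | insert l s _ ih =>
        have hil : s.piecewise c u i = M + 1 := by
          by_cases his : i ∈ s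
          · rw [Finset.piecewise_eq_of_mem _ _ _ his]
          · rw [Finset.piecewise_eq_of_notMem _ _ _ his, hi]
        rw [ih, Finset.piecewise_insert]
        by_cases hl : l = i
        · subst hl
          have : Function.update (s.piecewise c u) l (c l) = s.piecewise c u := by
            rw [Function.update_eq_self_iff, hil]
          rw [this]
        · exact hmove _ l i hl (by rw [hil]; exact hMc) _
    simpa using hs Finset.univ
  have hout : ∀ x, x ∉ latticeBox m M → (x ∈ B ↔ Multiplicative.ofAdd c ∈ B) := by
    intro x hx
    simp only [mem_latticeBox, not_forall, not_le] at hx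
    obtain ⟨j, hj⟩ := hx
    obtain ⟨i, hij⟩ := exists_ne j
    rw [← ofAdd_toAdd x, hmove _ i j hij hj (M + 1)]
    exact hcanon _ i (by simp)
  obtain ⟨x, hxB, hx⟩ := hB.exists_notMem_finset (latticeBox m M)
  refine (latticeBox m M).finite_toSet.subset fun y hy => ?_
  by_contra hy'
  exact hy ((hout y hy').2 ((hout x hx).1 hxB))

/-- The coordinates of adjacent vertices of a Cayley graph of the lattice differ by a bounded
amount. -/
theorem exists_abs_sub_le_of_adj {S : Set (Multiplicative (Fin m → ℤ))} (hS : S.Finite) :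
    ∃ L : ℕ, ∀ (M : ℕ) (u v : Multiplicative (Fin m → ℤ)), (cayley _ S).Adj u v →
      u ∈ latticeBox m M → v ∈ latticeBox m (M + L) := by
  obtain ⟨L, hL⟩ := exists_subset_latticeBox hS
  refine ⟨L, fun M u v huv hu => mem_latticeBox.2 fun i => ?_⟩
  have hu := mem_latticeBox.1 hu i
  have key : |v.toAdd i - u.toAdd i| ≤ L := by
    rcases (cayley_adj.1 huv).2 with h | h
    · have := mem_latticeBox.1 (hL h) i
      rw [toAdd_mul, toAdd_inv, Pi.add_apply, Pi.neg_apply] at this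
      rwa [neg_add_eq_sub] at this
    · have := mem_latticeBox.1 (hL h) i
      rw [toAdd_mul, toAdd_inv, Pi.add_apply, Pi.neg_apply] at this
      rwa [neg_add_eq_sub, abs_sub_comm] at this
  rw [abs_le] at *
  push_cast
  constructor <;> linarith

/-- A generating set of the lattice of rank `m` contains `m` linearly independent vectors. -/
theorem exists_linearIndependent_of_closure_eq_top {S : Set (Multiplicative (Fin m → ℤ))}
    (hS : Subgroup.closure S = ⊤) :
    ∃ s : Fin m → Fin m → ℤ, (∀ i, Multiplicative.ofAdd (s i) ∈ S) ∧
      LinearIndependent ℤ s := by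
  let ι : (Fin m → ℤ) →+ (Fin m → ℚ) := (Int.castAddHom ℚ).compLeft (Fin m)
  have hspan : ∀ x : Fin m → ℤ,
      ι x ∈ Submodule.span ℚ ((fun g => ι g.toAdd) '' S) := by
    intro x
    have hx : Multiplicative.ofAdd x ∈ Subgroup.closure S := hS ▸ Subgroup.mem_top _
    rw [← toAdd_ofAdd x]
    generalize Multiplicative.ofAdd x = g at hx
    induction hx using Subgroup.closure_induction with
    | mem g hg => exact Submodule.subset_span ⟨g, hg, rfl⟩
    | one => simp
    | mul x y _ _ hx hy =>
      rw [toAdd_mul, map_add]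
      exact add_mem hx hy
    | inv x _ hx =>
      rw [toAdd_inv, map_neg]
      exact neg_mem hx
  have htop : (⊤ : Submodule ℚ (Fin m → ℚ)) ≤ Submodule.span ℚ ((fun g => ι g.toAdd) '' S) := by
    rw [← (Pi.basisFun ℚ (Fin m)).span_eq, Submodule.span_le]
    rintro _ ⟨i, rfl⟩
    have hi : Pi.basisFun ℚ (Fin m) i = ι (Pi.single i 1) := by
      ext j
      by_cases hj : j = i
      · subst hj; simp [ι]
      · simp [ι, hj]
    rw [hi]
    exact hspan _
  let b := Module.Basis.ofSpan htop
  let b' := b.reindex (b.indexEquiv (Pi.basisFun ℚ (Fin m)))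
  have hb' : ∀ i, ∃ g ∈ S, ι g.toAdd = b' i := by
    intro i
    have : b' i ∈ Set.range b := ⟨_, (b.reindex_apply _ i).symm⟩
    exact Module.Basis.ofSpan_subset htop this
  choose g hgS hg using hb'
  refine ⟨fun i => (g i).toAdd, hgS, ?_⟩
  rw [Fintype.linearIndependent_iff]
  intro c hc i
  have h := congrArg ι hc
  rw [map_sum, map_zero] at h
  simp only [map_zsmul, hg] at h
  have := Fintype.linearIndependent_iff.1 b'.linearIndependent (fun i => (c i : ℚ))
    (by simpa only [Int.cast_smul_eq_zsmul] using h) i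
  exact_mod_cast this

end Lattice

/-- The lattice of rank `d + 3` has the finite-step retaining property of degree `d + 1`: the fire
is enclosed by a thickened sphere. -/
theorem finiteStepPolyRetaining_lattice (d : ℕ) {S : Set (Multiplicative (Fin (d + 3) → ℤ))}
    (hS : IsFiniteGenSet S) :
    FiniteStepPolyRetaining (cayley (Multiplicative (Fin (d + 3) → ℤ)) S) (d + 1) := by
  classical
  obtain ⟨L, hL⟩ := exists_abs_sub_le_of_adj hS.1
  refine ⟨2 * L * (d + 3) * (6 * L + 3) ^ (d + 2) + 1, by omega, fun X0 hX0 => ?_⟩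
  set K := 2 * L * (d + 3) * (6 * L + 3) ^ (d + 2) + 1 with hK
  obtain ⟨M, hM⟩ := exists_subset_latticeBox hX0
  obtain ⟨R, hR⟩ : ∃ R, R = M + 1 := ⟨_, rfl⟩
  obtain ⟨ρ, hρ⟩ : ∃ ρ, ρ = R + L * (2 * R) := ⟨_, rfl⟩
  have hshell : (latticeBox (d + 3) (ρ + L) \ latticeBox (d + 3) ρ).card ≤
      ∑ i ∈ Finset.Icc 1 (2 * R), K * i ^ (d + 1) := by
    rw [Finset.card_sdiff_of_subset (latticeBox_mono _ (by omega)), card_latticeBox,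
      card_latticeBox]
    have h1 : (2 * (ρ + L) + 1) ^ (d + 3) ≤ (2 * ρ + 1) ^ (d + 3) +
        2 * L * (d + 3) * (2 * (ρ + L) + 1) ^ (d + 2) := by
      have := abs_pow_sub_pow_le ((2 * (ρ + L) + 1 : ℕ) : ℤ) ((2 * ρ + 1 : ℕ) : ℤ) (d + 3)
      rw [Nat.abs_cast, Nat.abs_cast, max_eq_left (by push_cast; omega)] at this
      have h3 := (le_abs_self _).trans this
      have h4 : |((2 * (ρ + L) + 1 : ℕ) : ℤ) - ((2 * ρ + 1 : ℕ) : ℤ)| = 2 * L := by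
        rw [abs_of_nonneg] <;> push_cast <;> linarith
      rw [h4] at h3
      simp only [Nat.add_succ_sub_one] at h3
      zify
      push_cast at h3
      linarith
    calc _ ≤ 2 * L * (d + 3) * (2 * (ρ + L) + 1) ^ (d + 2) := by omega
      _ ≤ 2 * L * (d + 3) * ((6 * L + 3) * R) ^ (d + 2) := by
          gcongr
          have : L ≤ L * R := Nat.le_mul_of_pos_right L (by omega)
          rw [hρ]
          linarith
      _ = (2 * L * (d + 3) * (6 * L + 3) ^ (d + 2)) * R ^ (d + 2) := by rw [mul_pow]; ring
      _ ≤ K * R ^ (d + 2) := by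
          gcongr
          omega
      _ = ∑ i ∈ Finset.Icc (R + 1) (2 * R), K * R ^ (d + 1) := by
          rw [Finset.sum_const, Nat.card_Icc, smul_eq_mul]
          have : 2 * R + 1 - (R + 1) = R := by omega
          rw [this]
          ring
      _ ≤ ∑ i ∈ Finset.Icc (R + 1) (2 * R), K * i ^ (d + 1) := by
          refine Finset.sum_le_sum fun i hi => ?_
          have := (Finset.mem_Icc.1 hi).1
          gcongr
          omega
      _ ≤ _ := Finset.sum_le_sum_of_subset (Finset.Icc_subset_Icc_left (by omega))
  obtain ⟨W, hW, hW0, hWs⟩ := exists_strategy_of_card_le _ _ _ hshell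
  have hearly : ∀ n, fireSet (cayley _ S) 1 W X0 n ⊆ latticeBox (d + 3) (R + L * n) := by
    intro n
    induction n with
    | zero => exact hM.trans (Finset.coe_subset.2 (latticeBox_mono _ (by omega)))
    | succ n ih =>
      intro v hv
      rcases mem_fireSet_one_succ.1 hv with hv | ⟨-, u, hu, huv⟩
      · exact latticeBox_mono _ (by gcongr; omega) (ih hv)
      · have h := hL (R + L * n) u v huv (ih hu)
        rwa [add_assoc, ← Nat.mul_succ] at h
  have hlate : ∀ n, fireSet (cayley _ S) 1 W X0 n ⊆ latticeBox (d + 3) ρ := by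
    intro n
    rcases le_total n (2 * R) with hn | hn
    · exact (hearly n).trans (Finset.coe_subset.2 (latticeBox_mono _ (by rw [hρ]; gcongr)))
    induction n, hn using Nat.le_induction with
    | base => exact hρ ▸ hearly _
    | succ n hn ih =>
      intro v hv
      rcases mem_fireSet_one_succ.1 hv with hv | ⟨hvW, u, hu, huv⟩
      · exact ih hv
      · by_contra hvρ
        refine hvW (protectedUpTo_mono W (by omega) (hWs ?_))
        exact Finset.mem_coe.2 (Finset.mem_sdiff.2 ⟨hL _ u v huv (ih hu), hvρ⟩)
  refine ⟨W, ⟨hW, ?_⟩, 2 * R + 1, fun n hn => hW0 n (by omega)⟩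
  exact growthEqFull_compl_of_finite (cayley_connected hS.2) (cayley_neighborSet_finite hS.1)
    ((latticeBox (d + 3) ρ).finite_toSet.subset (Set.iUnion_subset hlate))

/-- A fire on the lattice which is not contained by a finite-step strategy burns all but finitely
many vertices. -/
theorem finite_compl_burnedSet {m : ℕ} [Nontrivial (Fin m)]
    {S : Set (Multiplicative (Fin m → ℤ))} (hS : IsFiniteGenSet S) {f : ℕ → ℕ}
    {W : ℕ → Set (Multiplicative (Fin m → ℤ))} {X0 : Set (Multiplicative (Fin m → ℤ))}
    (hW : IsStrategyBound f W) (hW' : FiniteStepStrategy W)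
    (hinf : (burnedSet (cayley _ S) 1 W X0).Infinite) :
    (burnedSet (cayley _ S) 1 W X0)ᶜ.Finite := by
  obtain ⟨N, hN⟩ := hW'
  have hF : ∀ n, protectedUpTo W n ⊆ protectedUpTo W N := by
    intro n x hx
    simp only [protectedUpTo, Set.mem_iUnion, exists_prop, Finset.mem_Icc] at hx ⊢
    obtain ⟨i, hi, hxi⟩ := hx
    refine ⟨i, ⟨hi.1, ?_⟩, hxi⟩
    by_contra! h
    simp [hN i h.le] at hxi
  have hclosed : ∀ u ∈ burnedSet (cayley _ S) 1 W X0, ∀ v, (cayley _ S).Adj u v →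
      v ∉ protectedUpTo W N → v ∈ burnedSet (cayley _ S) 1 W X0 := by
    intro u hu v huv hv
    obtain ⟨n, hn⟩ := Set.mem_iUnion.1 hu
    exact Set.mem_iUnion.2
      ⟨n + 1, mem_fireSet_one_succ.2 (Or.inr ⟨fun h => hv (hF _ h), u, hn, huv⟩)⟩
  choose D hD hDiff using fun i : Fin m => exists_finite_forall_mem_iff_mul_mem hclosed
    (g := Multiplicative.ofAdd (Pi.single i 1)) (hS.2 ▸ Subgroup.mem_top _)
  refine finite_compl_of_unit_invariant hinf
    (E := ⋃ i, ⋃ x ∈ D i, (fun u => u * x⁻¹) '' protectedUpTo W N)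
    (Set.finite_iUnion fun i => (hD i).biUnion fun x _ => (protectedUpTo_finite hW N).image _) ?_
  intro i u hu
  refine hDiff i u fun x hx hux => hu ?_
  simp only [Set.mem_iUnion]
  exact ⟨i, x, hx, u * x, hux, by simp⟩

theorem not_finiteStepPolyRetaining_lattice (d : ℕ)
    {S : Set (Multiplicative (Fin (d + 3) → ℤ))} (hS : IsFiniteGenSet S) :
    ¬ FiniteStepPolyRetaining (cayley (Multiplicative (Fin (d + 3) → ℤ)) S) d := by
  rintro ⟨K, -, hret⟩
  obtain ⟨s, hsS, hs⟩ := exists_linearIndependent_of_closure_eq_top hS.2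
  let coef : ℕ → (Fin (d + 2) → ℤ) → Fin (d + 3) → ℤ := fun n y => Fin.snoc y (n - ∑ i, y i)
  let φ : ℕ → (Fin (d + 2) → ℤ) → Multiplicative (Fin (d + 3) → ℤ) := fun n y =>
    Multiplicative.ofAdd (∑ j, coef n y j • s j)
  have hinj : ∀ n y n' y', φ n y = φ n' y' → n = n' ∧ y = y' := by
    intro n y n' y' h
    have hc : coef n y = coef n' y' := by
      exact hs.fintypeLinearCombination_injective (Multiplicative.ofAdd.injective h)
    obtain ⟨rfl, h2⟩ := Fin.snoc_inj.1 hc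
    exact ⟨by simpa using h2, rfl⟩
  have hadj : ∀ n y n' y' j, coef n' y' = coef n y + Pi.single j 1 →
      (cayley _ S).Adj (φ n y) (φ n' y') := by
    intro n y n' y' j h
    have hφ : φ n' y' = φ n y * Multiplicative.ofAdd (s j) := by
      simp only [φ, h, ← ofAdd_add, Pi.add_apply, add_smul, Finset.sum_add_distrib]
      congr 2
      simp [Pi.single_apply]
    rw [hφ, cayley_adj]
    refine ⟨fun h0 => hs.ne_zero j ?_, Or.inl ?_⟩
    · rw [left_eq_mul] at h0
      exact ofAdd_eq_one.1 h0
    · rw [inv_mul_cancel_left]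
      exact hsS j
  obtain ⟨X0, hX0, hX⟩ := exists_burnedSet_infinite (G := cayley _ S) φ hinj
    (fun n y => hadj _ _ _ _ (Fin.last _) (by
      ext j
      refine Fin.lastCases ?_ (fun j => ?_) j
      · simp [coef]; ring
      · simp [coef]))
    (fun n y i => hadj _ _ _ _ i.castSucc (by
      ext j
      refine Fin.lastCases ?_ (fun j => ?_) j
      · simp [coef, Finset.sum_add_distrib]
      · by_cases hj : j = i
        · subst hj; simp [coef]
        · simp [coef, hj])) K
  obtain ⟨W, ⟨hW, hgrowth⟩, hfs⟩ := hret X0 hX0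
  exact hgrowth.infinite (cayley_connected hS.2) (cayley_neighborSet_finite hS.1)
    (finite_compl_burnedSet hS hW hfs (hX W hW))

theorem stmt19 (d : ℕ) (S : Set (Multiplicative (Fin (d + 3) → ℤ)))
    (hS : IsFiniteGenSet S) :
    FiniteStepPolyRetaining (cayley (Multiplicative (Fin (d + 3) → ℤ)) S) (d + 1) ∧
    ¬ FiniteStepPolyRetaining (cayley (Multiplicative (Fin (d + 3) → ℤ)) S) d :=
  ⟨finiteStepPolyRetaining_lattice d hS, not_finiteStepPolyRetaining_lattice d hS⟩
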